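/- Let N ≥ 1, p > 0, and α, β ∈ ℝ with N + α − 2 > 0 and N + α − 2 < (2(β − α + 2)/(p + 1))(p + √(p(p+1))). Let ω₁(x) = (1 + |x|²)^{α/2} and ω₂(x) = g(x)(1 + |x|²)^{β/2}, where g : ℝ^N → ℝ is a smooth positive function with lim_{|x|→∞} g(x) = c for some constant c ∈ (0, ∞). Then there is no positive stable super-solution of the equation −div(ω₁ ∇u) = −ω₂ u^{−p} in ℝ^N. -/

import Mathlib

open MeasureTheory Filter Real
open scoped RealInnerProductSpace

noncomputable def vdiv {N : ℕ} (V : EuclideanSpace ℝ (Fin N) → EuclideanSpace ℝ (Fin N))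
    (x : EuclideanSpace ℝ (Fin N)) : ℝ :=
  LinearMap.trace ℝ (EuclideanSpace ℝ (Fin N)) (fderiv ℝ V x).toLinearMap

def annulus (N : ℕ) (R : ℝ) : Set (EuclideanSpace ℝ (Fin N)) :=
  {x | R < ‖x‖ ∧ ‖x‖ < 2 * R}

section Gradient

variable {F : Type*} [NormedAddCommGroup F] [InnerProductSpace ℝ F] [CompleteSpace F]

theorem HasGradientAt.fun_mul {f g : F → ℝ} {f' g' x : F} (hf : HasGradientAt f f' x)
    (hg : HasGradientAt g g' x) :
    HasGradientAt (fun y => f y * g y) (f x • g' + g x • f') x := by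
  rw [hasGradientAt_iff_hasFDerivAt] at *
  rw [map_add, map_smul, map_smul]
  exact hf.mul hg

theorem HasDerivAt.comp_hasGradientAt {h : ℝ → ℝ} {h' : ℝ} {f : F → ℝ} {f' x : F}
    (hh : HasDerivAt h h' (f x)) (hf : HasGradientAt f f' x) :
    HasGradientAt (fun y => h (f y)) (h' • f') x := by
  rw [hasGradientAt_iff_hasFDerivAt] at *
  rw [map_smul]
  exact hh.comp_hasFDerivAt x hf

theorem HasGradientAt.rpow_const {f : F → ℝ} {f' x : F} (hf : HasGradientAt f f' x)
    (hx : f x ≠ 0) (r : ℝ) :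
    HasGradientAt (fun y => f y ^ r) ((r * f x ^ (r - 1)) • f') x :=
  (Real.hasDerivAt_rpow_const (Or.inl hx)).comp_hasGradientAt hf

theorem ContDiff.gradient {f : F → ℝ} {n m : WithTop ℕ∞} (hf : ContDiff ℝ n f) (hmn : m + 1 ≤ n) :
    ContDiff ℝ m (gradient f) :=
  (InnerProductSpace.toDual ℝ F).symm.contDiff.comp (hf.fderiv_right hmn)

theorem HasCompactSupport.gradient {f : F → ℝ} (hf : HasCompactSupport f) :
    HasCompactSupport (gradient f) :=
  (hf.fderiv (𝕜 := ℝ)).comp_left (g := (InnerProductSpace.toDual ℝ F).symm) (map_zero _)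

theorem norm_gradient_comp_smul (f : F → ℝ) (c : ℝ) (x : F) :
    ‖gradient (fun y => f (c • y)) x‖ = |c| * ‖gradient f (c • x)‖ := by
  simp only [gradient, LinearIsometryEquiv.norm_map]
  rw [fderiv_comp_smul, norm_smul, Real.norm_eq_abs]

end Gradient

theorem integral_mul_vdiv {N : ℕ} {f : EuclideanSpace ℝ (Fin N) → ℝ}
    {V : EuclideanSpace ℝ (Fin N) → EuclideanSpace ℝ (Fin N)} (hf : ContDiff ℝ 1 f)
    (hfc : HasCompactSupport f) (hV : ContDiff ℝ 1 V) :
    ∫ x, f x * vdiv V x = -∫ x, ⟪gradient f x, V x⟫ := by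
  let b := EuclideanSpace.basisFun (Fin N) ℝ
  have hVd : Differentiable ℝ V := hV.differentiable (by norm_num)
  have hcomp : ∀ i, ContDiff ℝ 1 (fun x => ⟪b i, V x⟫) := fun i => contDiff_const.inner ℝ hV
  have hfd : ∀ v, Continuous (fun x => fderiv ℝ f x v) := fun v =>
    (hf.continuous_fderiv (by norm_num)).clm_apply continuous_const
  have hfi : ∀ i, Integrable (fun x => fderiv ℝ f x (b i) * ⟪b i, V x⟫) := fun i =>
    ((hfd _).mul (hcomp i).continuous).integrable_of_hasCompactSupport
      ((hfc.fderiv_apply (𝕜 := ℝ) (b i)).mul_right)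
  have hgi : ∀ i, Integrable (fun x => f x * fderiv ℝ (fun x => ⟪b i, V x⟫) x (b i)) := fun i =>
    (hf.continuous.mul (((hcomp i).continuous_fderiv (by norm_num)).clm_apply
      continuous_const)).integrable_of_hasCompactSupport hfc.mul_right
  have e1 : ∀ x, f x * vdiv V x = ∑ i, f x * fderiv ℝ (fun x => ⟪b i, V x⟫) x (b i) := by
    intro x
    rw [vdiv, LinearMap.trace_eq_sum_inner _ b, Finset.mul_sum]
    refine Finset.sum_congr rfl fun i _ => ?_
    rw [fderiv_inner_apply ℝ (differentiableAt_const _) (hVd x)]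
    simp
  have e2 : ∀ x, ⟪gradient f x, V x⟫ = ∑ i, fderiv ℝ f x (b i) * ⟪b i, V x⟫ := by
    intro x
    rw [← b.sum_inner_mul_inner]
    simp only [inner_gradient_left]
  simp only [e1, e2]
  rw [integral_finsetSum _ fun i _ => hgi i, integral_finsetSum _ fun i _ => hfi i,
    ← Finset.sum_neg_distrib]
  refine Finset.sum_congr rfl fun i _ => ?_
  exact integral_mul_fderiv_eq_neg_fderiv_mul_of_integrable (hfi i) (hgi i)
    ((hf.continuous.mul (hcomp i).continuous).integrable_of_hasCompactSupport hfc.mul_right)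
    (fun x _ => hf.differentiable (by norm_num) x)
    (fun x _ => (hcomp i).differentiable (by norm_num) x)

theorem norm_smul_add_smul_sq {F : Type*} [NormedAddCommGroup F] [InnerProductSpace ℝ F]
    (a b : ℝ) (v w : F) :
    ‖a • v + b • w‖ ^ 2 = a ^ 2 * ‖v‖ ^ 2 + 2 * (a * b) * ⟪v, w⟫ + b ^ 2 * ‖w‖ ^ 2 := by
  rw [norm_add_sq_real, norm_smul, norm_smul, real_inner_smul_left, real_inner_smul_right,
    mul_pow, mul_pow, Real.norm_eq_abs, Real.norm_eq_abs, sq_abs, sq_abs]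
  ring

theorem caccioppoli_pointwise {F : Type*} [NormedAddCommGroup F] [InnerProductSpace ℝ F]
    {s K D : ℝ} (hD : 0 < D) (hDe : D = K * (2 * s + 1) - s ^ 2) (a b : ℝ) (v w : F) :
    ‖(-s * a) • v + b • w‖ ^ 2 + K * (2 * (a * b) * ⟪v, w⟫ - (2 * s + 1) * (a ^ 2 * ‖v‖ ^ 2))
      ≤ (1 + (K - s) ^ 2 / D) * (b ^ 2 * ‖w‖ ^ 2) := by
  have h := sq_nonneg (‖D • (a • v) + (-(K - s)) • (b • w)‖)
  rw [norm_smul_add_smul_sq, real_inner_smul_left, real_inner_smul_right, norm_smul, norm_smul,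
    mul_pow, mul_pow, Real.norm_eq_abs, Real.norm_eq_abs, sq_abs, sq_abs] at h
  rw [norm_smul_add_smul_sq]
  have h' : 0 ≤ D * (a ^ 2 * ‖v‖ ^ 2) - 2 * (K - s) * (a * b) * ⟪v, w⟫
      + (K - s) ^ 2 / D * (b ^ 2 * ‖w‖ ^ 2) := by
    refine (div_nonneg h hD.le).trans_eq ?_
    field_simp
    ring
  subst hDe
  linarith

theorem integrable_mul_norm_gradient_sq {N : ℕ} {a f : EuclideanSpace ℝ (Fin N) → ℝ}
    (ha : Continuous a) (hf : ContDiff ℝ 1 f) (hfc : HasCompactSupport f) :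
    Integrable (fun x => a x * ‖gradient f x‖ ^ 2) :=
  (ha.mul ((hf.gradient (m := 0) (by norm_num)).continuous.norm.pow
    2)).integrable_of_hasCompactSupport
    (hfc.gradient.mono fun x hx h0 => hx (by simp [h0]))

/-- Energy estimate for positive stable super-solutions `u` of `-div (ω₁ ∇u) = -ω₂ u ^ (-p)`. -/
theorem exists_integral_le_of_stable {N : ℕ} {p s : ℝ} (hs : 0 < s) (hsp : s ^ 2 < p * (2 * s + 1))
    {ω₁ ω₂ u : EuclideanSpace ℝ (Fin N) → ℝ} (hω₁ : ContDiff ℝ 1 ω₁) (hω₁pos : ∀ x, 0 < ω₁ x)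
    (hω₂ : Continuous ω₂) (hu : ContDiff ℝ 2 u) (hupos : ∀ x, 0 < u x)
    (hsuper : ∀ x, -(ω₂ x * u x ^ (-p)) ≤ -vdiv (fun y => ω₁ y • gradient u y) x)
    (hstable : ∀ ψ : EuclideanSpace ℝ (Fin N) → ℝ, ContDiff ℝ 2 ψ → HasCompactSupport ψ →
      ∫ x, p * ω₂ x * u x ^ (-p - 1) * ψ x ^ 2 ≤ ∫ x, ω₁ x * ‖gradient ψ x‖ ^ 2) :
    ∃ C, 0 < C ∧ ∀ η : EuclideanSpace ℝ (Fin N) → ℝ, ContDiff ℝ 2 η → HasCompactSupport η →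
      ∫ x, ω₂ x * u x ^ (-p - 1) * (η x * u x ^ (-s)) ^ 2
        ≤ C * ∫ x, ω₁ x * ((u x ^ (-s)) ^ 2 * ‖gradient η x‖ ^ 2) := by
  have hs1 : 0 < 2 * s + 1 := by linarith
  obtain ⟨K, hK1, hK2⟩ := exists_between ((div_lt_iff₀ hs1).2 hsp)
  have hK0 : 0 < K := lt_of_le_of_lt (by positivity) hK1
  obtain ⟨D, hDe⟩ : ∃ D, D = K * (2 * s + 1) - s ^ 2 := ⟨_, rfl⟩
  have hD : 0 < D := by
    rw [hDe]; have := (div_lt_iff₀ hs1).1 hK1; linarith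
  have hC : 0 < 1 + (K - s) ^ 2 / D := by positivity
  refine ⟨(1 + (K - s) ^ 2 / D) / (p - K), div_pos hC (by linarith), fun η hη hηc => ?_⟩
  have hrpow : ∀ (r : ℝ), ContDiff ℝ 2 fun x => u x ^ r := fun r =>
    hu.rpow_const_of_ne fun x => (hupos x).ne'
  have hu' : ∀ x, HasGradientAt u (gradient u x) x := fun x =>
    (hu.differentiable (by norm_num) x).hasGradientAt
  have hη' : ∀ x, HasGradientAt η (gradient η x) x := fun x =>
    (hη.differentiable (by norm_num) x).hasGradientAt
  have hψ2 : ContDiff ℝ 2 (fun x => η x * u x ^ (-s)) := hη.mul (hrpow _)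
  have hψc : HasCompactSupport (fun x => η x * u x ^ (-s)) := hηc.mul_right
  have hf2 : ContDiff ℝ 2 (fun x => η x * (η x * u x ^ (-(2 * s + 1)))) :=
    hη.mul (hη.mul (hrpow _))
  have hfc : HasCompactSupport (fun x => η x * (η x * u x ^ (-(2 * s + 1)))) := hηc.mul_right
  have hgu : ContDiff ℝ 1 (gradient u) := hu.gradient (by norm_num)
  have hV : ContDiff ℝ 1 (fun y => ω₁ y • gradient u y) := hω₁.smul hgu
  have hu0 : ∀ x, u x ^ (-s) = u x ^ (-s - 1) * u x := fun x => by
    rw [← Real.rpow_add_one (hupos x).ne']; congr 1; ring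
  have hu1 : ∀ x, u x ^ (-(2 * s + 1)) = (u x ^ (-s - 1)) ^ 2 * u x := fun x => by
    rw [← Real.rpow_natCast, ← Real.rpow_mul (hupos x).le, ← Real.rpow_add_one (hupos x).ne']
    congr 1; push_cast; ring
  have hu2 : ∀ x, u x ^ (-(2 * s + 1) - 1) = (u x ^ (-s - 1)) ^ 2 := fun x => by
    rw [← Real.rpow_natCast, ← Real.rpow_mul (hupos x).le]
    congr 1; push_cast; ring
  have hup : ∀ x, u x ^ (-p) = u x ^ (-p - 1) * u x := fun x => by
    rw [← Real.rpow_add_one (hupos x).ne']; congr 1; ring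
  have hgψ : ∀ x, gradient (fun x => η x * u x ^ (-s)) x
      = (-s * (η x * u x ^ (-s - 1))) • gradient u x + u x ^ (-s) • gradient η x := fun x => by
    rw [((hη' x).fun_mul ((hu' x).rpow_const (hupos x).ne' _)).gradient, smul_smul]
    congr 2; ring
  have hgf : ∀ x, ⟪gradient (fun x => η x * (η x * u x ^ (-(2 * s + 1)))) x,
      ω₁ x • gradient u x⟫ = ω₁ x * (2 * (η x * u x ^ (-s - 1) * u x ^ (-s))
        * ⟪gradient u x, gradient η x⟫ - (2 * s + 1) * ((η x * u x ^ (-s - 1)) ^ 2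
        * ‖gradient u x‖ ^ 2)) := fun x => by
    rw [((hη' x).fun_mul ((hη' x).fun_mul ((hu' x).rpow_const (hupos x).ne' _))).gradient]
    simp only [inner_add_left, real_inner_smul_left, real_inner_smul_right,
      real_inner_self_eq_norm_sq, smul_add, smul_smul]
    rw [hu2, hu1, hu0, real_inner_comm (gradient u x)]
    ring
  have hst := hstable _ hψ2 hψc
  have hS : Integrable (fun x => ω₁ x * ‖gradient (fun x => η x * u x ^ (-s)) x‖ ^ 2) :=
    integrable_mul_norm_gradient_sq hω₁.continuous (hψ2.of_le (by norm_num)) hψc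
  have hQ : Integrable (fun x => ω₁ x * ((u x ^ (-s)) ^ 2 * ‖gradient η x‖ ^ 2)) := by
    simp only [← mul_assoc]
    exact integrable_mul_norm_gradient_sq (hω₁.continuous.mul ((hrpow _).continuous.pow 2))
      (hη.of_le (by norm_num)) hηc
  have hT : Integrable (fun x => ⟪gradient (fun x => η x * (η x * u x ^ (-(2 * s + 1)))) x,
      ω₁ x • gradient u x⟫) := by
    refine ((hf2.gradient (m := 0) (by norm_num)).continuous.inner
      hV.continuous).integrable_of_hasCompactSupport ?_
    exact hfc.gradient.mono fun x hx h0 => hx (by simp only [h0, inner_zero_left])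
  have hG : Integrable (fun x => ω₂ x * u x ^ (-p - 1) * (η x * u x ^ (-s)) ^ 2) :=
    ((hω₂.mul (hrpow _).continuous).mul (hψ2.continuous.pow 2)).integrable_of_hasCompactSupport
      (hψc.mono fun x hx h0 => hx (by simp [h0]))
  have hvd : Integrable (fun x => η x * (η x * u x ^ (-(2 * s + 1))) *
      vdiv (fun y => ω₁ y • gradient u y) x) := by
    refine Continuous.integrable_of_hasCompactSupport (hf2.continuous.mul ?_) hfc.mul_right
    exact ((LinearMap.trace ℝ (EuclideanSpace ℝ (Fin N))).comp
      (ContinuousLinearMap.coeLM ℝ)).continuous_of_finiteDimensional.comp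
      (hV.continuous_fderiv (by norm_num))
  have hpos2 : 0 ≤ (∫ x, ω₂ x * u x ^ (-p - 1) * (η x * u x ^ (-s)) ^ 2)
      + ∫ x, ⟪gradient (fun x => η x * (η x * u x ^ (-(2 * s + 1)))) x,
      ω₁ x • gradient u x⟫ := by
    have hle := integral_mono hvd hG (fun x => by
      have h1 : η x * (η x * u x ^ (-(2 * s + 1))) * vdiv (fun y => ω₁ y • gradient u y) x
          ≤ η x * (η x * u x ^ (-(2 * s + 1))) * (ω₂ x * u x ^ (-p)) := by
        refine mul_le_mul_of_nonneg_left (neg_le_neg_iff.1 (hsuper x)) ?_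
        rw [← mul_assoc]
        exact mul_nonneg (mul_self_nonneg _) (Real.rpow_nonneg (hupos x).le _)
      refine h1.trans_eq ?_
      simp only [hup, hu1, hu0]
      ring)
    rw [integral_mul_vdiv (hf2.of_le (by norm_num)) hfc hV] at hle
    linarith
  have hST := integral_mono (hS.add (hT.const_mul K)) (hQ.const_mul (1 + (K - s) ^ 2 / D))
    (fun x => by
      have := mul_le_mul_of_nonneg_left (caccioppoli_pointwise hD hDe (η x * u x ^ (-s - 1))
        (u x ^ (-s)) (gradient u x) (gradient η x)) (hω₁pos x).le
      simp only [Pi.add_apply, hgψ, hgf]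
      linarith)
  rw [integral_add' hS (hT.const_mul K), integral_const_mul, integral_const_mul] at hST
  simp only [mul_assoc p] at hst
  rw [integral_const_mul] at hst
  rw [div_mul_eq_mul_div, le_div_iff₀ (by linarith)]
  linarith [mul_nonneg hK0.le hpos2]

theorem rpow_mul_pow_le_half_add {q C W τ a X : ℝ} {n : ℕ} (hq : 0 < q) (hqn : q ≤ n) (hC : 0 < C)
    (hW : 0 < W) (hτ : 0 < τ) (ha : 0 ≤ a) (ha1 : a ≤ 1) (hX : 0 ≤ X) :
    C * X * (τ ^ q * a ^ n) ≤ W * τ * a * (τ ^ q * a ^ n) / 2 + C * X * (2 * C * X / W) ^ q := by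
  have hZ : 0 ≤ τ ^ q * a ^ n := by positivity
  rcases le_total (2 * C * X) (W * τ * a) with h | h
  · have : 0 ≤ C * X * (2 * C * X / W) ^ q := by positivity
    nlinarith [mul_le_mul_of_nonneg_right h hZ]
  · have h1 : τ ^ q * a ^ n ≤ (2 * C * X / W) ^ q := by
      calc τ ^ q * a ^ n ≤ τ ^ q * a ^ q := by
            rw [← Real.rpow_natCast]
            exact mul_le_mul_of_nonneg_left
              (Real.rpow_le_rpow_of_exponent_ge' ha ha1 hq.le hqn) (by positivity)
        _ = (τ * a) ^ q := (Real.mul_rpow hτ.le ha).symm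
        _ ≤ _ := by
            gcongr
            rw [le_div_iff₀ hW]
            linarith
    have h2 := mul_le_mul_of_nonneg_left h1 (mul_nonneg hC.le hX)
    have : 0 ≤ W * τ * a * (τ ^ q * a ^ n) := by positivity
    linarith

theorem rpow_le_of_mem_Icc_sq {y R : ℝ} (hR : 0 < R) (h1 : R ^ 2 ≤ y) (h2 : y ≤ 5 * R ^ 2) (γ : ℝ) :
    y ^ γ ≤ 5 ^ |γ| * R ^ (2 * γ) := by
  have hR2 : 0 < R ^ 2 := by positivity
  have e : (R ^ 2) ^ γ = R ^ (2 * γ) := by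
    rw [← Real.rpow_natCast, ← Real.rpow_mul hR.le]; norm_num
  rw [← e]
  rcases le_total 0 γ with h | h
  · rw [abs_of_nonneg h, ← Real.mul_rpow (by norm_num) hR2.le]
    gcongr
    linarith
  · calc y ^ γ ≤ (R ^ 2) ^ γ := Real.rpow_le_rpow_of_nonpos hR2 h1 h
      _ ≤ _ := le_mul_of_one_le_left (by positivity)
        (Real.one_le_rpow (by norm_num) (abs_nonneg _))

theorem weight_quotient_le {q C c L α β R y h G : ℝ} (hq : 0 < q) (hC : 0 < C) (hc : 0 < c)
    (hR : 0 < R) (hh : 0 ≤ h) (hhL : h ≤ L / R) (h1 : R ^ 2 ≤ y) (h2 : y ≤ 5 * R ^ 2)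
    (hG : c ≤ G) :
    C * (y ^ (α / 2) * h ^ 2) * (2 * C * (y ^ (α / 2) * h ^ 2) / (G * y ^ (β / 2))) ^ q
      ≤ C * (2 * C / c) ^ q * L ^ 2 * (L ^ 2) ^ q * 5 ^ |(α + q * (α - β)) / 2|
        * R ^ (α + q * (α - β) - 2 - 2 * q) := by
  have hy : 0 < y := lt_of_lt_of_le (by positivity) h1
  have hyα := Real.rpow_pos_of_pos hy (α / 2)
  have hyβ := Real.rpow_pos_of_pos hy (β / 2)
  have hGpos : 0 < G := hc.trans_le hG
  calc _ ≤ C * (y ^ (α / 2) * (L / R) ^ 2)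
        * (2 * C * (y ^ (α / 2) * (L / R) ^ 2) / (c * y ^ (β / 2))) ^ q := by gcongr
    _ = C * (y ^ (α / 2) * (L / R) ^ 2)
        * (2 * C / c * L ^ 2 * y ^ ((α - β) / 2) * R ^ (-2 : ℝ)) ^ q := by
        congr 2
        rw [sub_div, Real.rpow_sub hy, Real.rpow_neg hR.le, Real.rpow_two]
        field_simp
    _ = C * (2 * C / c) ^ q * L ^ 2 * (L ^ 2) ^ q * y ^ ((α + q * (α - β)) / 2)
        * R ^ (-2 - 2 * q) := by
        rw [Real.mul_rpow (by positivity) (by positivity),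
          Real.mul_rpow (by positivity) (by positivity),
          Real.mul_rpow (by positivity) (by positivity), ← Real.rpow_mul hy.le,
          ← Real.rpow_mul hR.le, Real.rpow_sub hR, add_div, Real.rpow_add hy,
          Real.rpow_neg hR.le, Real.rpow_two]
        rw [show (α - β) / 2 * q = q * (α - β) / 2 by ring, show -2 * q = -(2 * q) by ring,
          Real.rpow_neg hR.le]
        field_simp
    _ ≤ C * (2 * C / c) ^ q * L ^ 2 * (L ^ 2) ^ q * (5 ^ |(α + q * (α - β)) / 2|
        * R ^ (2 * ((α + q * (α - β)) / 2))) * R ^ (-2 - 2 * q) := by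
        gcongr
        exact rpow_le_of_mem_Icc_sq hR h1 h2 _
    _ = _ := by
        rw [show α + q * (α - β) - 2 - 2 * q = 2 * ((α + q * (α - β)) / 2) + (-2 - 2 * q) by ring,
          Real.rpow_add hR]
        ring

/-- Smooth cutoff functions between the balls of radius `R` and `2 * R`. -/
theorem exists_cutoff (F : Type*) [NormedAddCommGroup F] [InnerProductSpace ℝ F]
    [FiniteDimensional ℝ F] :
    ∃ L : ℝ, ∀ R, 0 < R → ∃ φ : F → ℝ, ContDiff ℝ 2 φ ∧ HasCompactSupport φ ∧
      (∀ x, 0 ≤ φ x ∧ φ x ≤ 1) ∧ (∀ x, ‖x‖ ≤ R → φ x = 1) ∧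
      (∀ x, ‖gradient φ x‖ ≤ L / R) ∧
      ∀ x, gradient φ x ≠ 0 → R ≤ ‖x‖ ∧ ‖x‖ ≤ 2 * R := by
  let χ : ContDiffBump (0 : F) := ⟨1, 2, one_pos, one_lt_two⟩
  have hχ2 : ContDiff ℝ 2 χ := χ.contDiff
  obtain ⟨L, hL⟩ := χ.hasCompactSupport.gradient.exists_bound_of_continuous
    (hχ2.gradient (m := 0) (by norm_num)).continuous
  refine ⟨L, fun R hR => ?_⟩
  have hn : ∀ x : F, ‖R⁻¹ • x‖ = ‖x‖ / R := fun x => by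
    rw [norm_smul, norm_inv, Real.norm_of_nonneg hR.le]; ring
  refine ⟨fun x => χ (R⁻¹ • x), hχ2.comp (contDiff_const_smul _),
    χ.hasCompactSupport.comp_smul (inv_ne_zero hR.ne'), fun x => ⟨χ.nonneg, χ.le_one⟩,
    fun x hx => χ.one_of_mem_closedBall ?_, fun x => ?_, fun x hx => ?_⟩
  · rw [mem_closedBall_zero_iff, hn, div_le_iff₀ hR, one_mul]
    exact hx
  · rw [norm_gradient_comp_smul, abs_of_pos (inv_pos.2 hR), div_eq_inv_mul]
    exact mul_le_mul_of_nonneg_left (hL _) (inv_pos.2 hR).le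
  · have hx' : gradient χ (R⁻¹ • x) ≠ 0 := fun h0 => hx (by
      rw [← norm_eq_zero, norm_gradient_comp_smul, h0, norm_zero, mul_zero])
    constructor
    · by_contra! h
      refine hx' (((χ.eventuallyEq_one_of_mem_ball ?_).gradient_eq).trans (gradient_const _ (1 : ℝ)))
      rw [mem_ball_zero_iff, hn, div_lt_iff₀ hR, one_mul]
      exact h
    · have h2 : R⁻¹ • x ∈ tsupport χ := by
        by_contra hc
        exact hx' (by rw [gradient, fderiv_of_notMem_tsupport ℝ hc, map_zero])
      rw [χ.tsupport_eq, mem_closedBall_zero_iff, hn, div_le_iff₀ hR] at h2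
      exact h2

theorem exists_subcritical_exponent {p A b : ℝ} (hp : 0 < p) (hA : 0 < A)
    (h : A < 2 * b / (p + 1) * (p + Real.sqrt (p * (p + 1)))) :
    ∃ s, 0 < s ∧ s ^ 2 < p * (2 * s + 1) ∧ A < 2 * s / (p + 1) * b := by
  have hS : 0 < p + √(p * (p + 1)) := by positivity
  have hb : 0 < 2 * b / (p + 1) := pos_of_mul_pos_left (hA.trans h) hS.le
  obtain ⟨s, hs1, hs2⟩ := exists_between ((div_lt_iff₀' hb).2 h)
  have hs : 0 < s := (div_pos hA hb).trans hs1
  refine ⟨s, hs, ?_, ?_⟩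
  · have h3 := (Real.lt_sqrt (y := p * (p + 1)) (x := |s - p|) (abs_nonneg _)).1 (abs_lt.2
      ⟨by linarith [Real.lt_sqrt_of_sq_lt (show p ^ 2 < p * (p + 1) by nlinarith)], by linarith⟩)
    rw [sq_abs] at h3
    linarith
  · have := (div_lt_iff₀ hb).1 hs1
    calc A < _ := this
      _ = _ := by ring

/-- Decay of the weighted integrals of a stable super-solution, up to a cutoff. -/
theorem setIntegral_ball_le_of_energy {N : ℕ} {p s C c L α β R : ℝ} {n : ℕ} (hp : 0 < p)
    (hs : 0 < s) (hn : 2 * s / (p + 1) ≤ n) (hC : 0 < C) (hc : 0 < c) (hR : 1 ≤ R)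
    {g u φ : EuclideanSpace ℝ (Fin N) → ℝ} (hg : Continuous g) (hgpos : ∀ x, 0 < g x)
    (hgR : ∀ x, R ≤ ‖x‖ → c ≤ g x) (hu : Continuous u) (hupos : ∀ x, 0 < u x)
    (henergy : ∀ η : EuclideanSpace ℝ (Fin N) → ℝ, ContDiff ℝ 2 η → HasCompactSupport η →
      ∫ x, g x * (1 + ‖x‖ ^ 2) ^ (β / 2) * u x ^ (-p - 1) * (η x * u x ^ (-s)) ^ 2
        ≤ C * ∫ x, (1 + ‖x‖ ^ 2) ^ (α / 2) * ((u x ^ (-s)) ^ 2 * ‖gradient η x‖ ^ 2))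
    (hφ : ContDiff ℝ 2 φ) (hφc : HasCompactSupport φ) (hφ01 : ∀ x, 0 ≤ φ x ∧ φ x ≤ 1)
    (hφ1 : ∀ x, ‖x‖ ≤ R → φ x = 1) (hφL : ∀ x, ‖gradient φ x‖ ≤ L / R)
    (hφR : ∀ x, gradient φ x ≠ 0 → R ≤ ‖x‖ ∧ ‖x‖ ≤ 2 * R) {M : ℝ}
    (hM : M = C * (n + 1) ^ 2 * (2 * (C * (n + 1) ^ 2) / c) ^ (2 * s / (p + 1)) * L ^ 2
      * (L ^ 2) ^ (2 * s / (p + 1)) * 5 ^ |(α + 2 * s / (p + 1) * (α - β)) / 2|) :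
    ∫ x in Metric.ball 0 1, g x * (1 + ‖x‖ ^ 2) ^ (β / 2) * u x ^ (-p - 1) * (u x ^ (-s)) ^ 2
      ≤ 2 * M * 2 ^ N * volume.real (Metric.closedBall (0 : EuclideanSpace ℝ (Fin N)) 1)
        * R ^ (-(2 * s / (p + 1) * (β - α + 2) - (N + α - 2))) := by
  have hR0 : 0 < R := by linarith
  obtain ⟨q, hqe⟩ : ∃ q, q = 2 * s / (p + 1) := ⟨_, rfl⟩
  rw [← hqe] at hM hn ⊢
  have hq : 0 < q := hqe ▸ by positivity
  have hM0 : 0 ≤ M := hM ▸ by positivity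
  have hy : ∀ x : EuclideanSpace ℝ (Fin N), 0 < 1 + ‖x‖ ^ 2 := fun x => by positivity
  have hyc : ∀ γ : ℝ, Continuous fun x : EuclideanSpace ℝ (Fin N) => (1 + ‖x‖ ^ 2) ^ γ := fun γ =>
    (by fun_prop : Continuous fun x : EuclideanSpace ℝ (Fin N) => 1 + ‖x‖ ^ 2).rpow_const
      fun x => Or.inl (hy x).ne'
  have huc : ∀ γ : ℝ, Continuous fun x => u x ^ γ := fun γ =>
    hu.rpow_const fun x => Or.inl (hupos x).ne'
  have hη : ContDiff ℝ 2 (fun x => φ x ^ (n + 1)) := hφ.pow _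
  have hηc : HasCompactSupport (fun x => φ x ^ (n + 1)) :=
    hφc.comp_left (g := fun t => t ^ (n + 1)) (by simp)
  have hgη : ∀ x, gradient (fun x => φ x ^ (n + 1)) x = ((n + 1) * φ x ^ n) • gradient φ x :=
    fun x => by
      rw [((hasDerivAt_pow (n + 1) (φ x)).comp_hasGradientAt
        (hφ.differentiable (by norm_num) x).hasGradientAt).gradient]
      simp
  have hτ : ∀ x, (u x ^ (-s)) ^ 2 = (u x ^ (-p - 1)) ^ q := fun x => by
    rw [← Real.rpow_natCast, ← Real.rpow_mul (hupos x).le, ← Real.rpow_mul (hupos x).le, hqe]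
    congr 1
    push_cast
    field_simp
    ring
  have hpt : ∀ x, C * ((1 + ‖x‖ ^ 2) ^ (α / 2) * ((u x ^ (-s)) ^ 2
      * ‖gradient (fun x => φ x ^ (n + 1)) x‖ ^ 2))
      ≤ g x * (1 + ‖x‖ ^ 2) ^ (β / 2) * u x ^ (-p - 1) * (φ x ^ (n + 1) * u x ^ (-s)) ^ 2 / 2
        + (Metric.closedBall 0 (2 * R)).indicator
          (fun _ => M * R ^ (α + q * (α - β) - 2 - 2 * q)) x := fun x => by
    have h1 := rpow_mul_pow_le_half_add (C := C * (n + 1) ^ 2) hq hn (by positivity)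
      (mul_pos (hgpos x) (Real.rpow_pos_of_pos (hy x) (β / 2)))
      (Real.rpow_pos_of_pos (hupos x) (-p - 1)) (sq_nonneg (φ x))
      (pow_le_one₀ (hφ01 x).1 (hφ01 x).2)
      (X := (1 + ‖x‖ ^ 2) ^ (α / 2) * ‖gradient φ x‖ ^ 2)
      (mul_nonneg (Real.rpow_nonneg (hy x).le _) (sq_nonneg _))
    have h2 : C * (n + 1) ^ 2 * ((1 + ‖x‖ ^ 2) ^ (α / 2) * ‖gradient φ x‖ ^ 2)
        * (2 * (C * (n + 1) ^ 2) * ((1 + ‖x‖ ^ 2) ^ (α / 2) * ‖gradient φ x‖ ^ 2)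
          / (g x * (1 + ‖x‖ ^ 2) ^ (β / 2))) ^ q
        ≤ (Metric.closedBall 0 (2 * R)).indicator
          (fun _ => M * R ^ (α + q * (α - β) - 2 - 2 * q)) x := by
      by_cases h0 : gradient φ x = 0
      · rw [h0, norm_zero]
        simp only [ne_eq, OfNat.ofNat_ne_zero, not_false_eq_true, zero_pow, mul_zero, zero_mul]
        exact Set.indicator_nonneg (fun _ _ => by positivity) x
      · obtain ⟨h3, h4⟩ := hφR x h0
        rw [Set.indicator_of_mem (mem_closedBall_zero_iff.2 h4), hM]
        exact weight_quotient_le hq (by positivity) hc hR0 (norm_nonneg _) (hφL x)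
          (by nlinarith) (by nlinarith) (hgR x h3)
    refine le_trans (le_of_eq ?_) ((h1.trans (add_le_add_right h2 _)).trans (le_of_eq ?_))
    · rw [hgη, norm_smul, mul_pow, Real.norm_eq_abs, sq_abs, hτ]
      ring
    · rw [mul_pow, hτ]
      ring
  have hG : Integrable (fun x => g x * (1 + ‖x‖ ^ 2) ^ (β / 2) * u x ^ (-p - 1)
      * (φ x ^ (n + 1) * u x ^ (-s)) ^ 2) :=
    (((hg.mul (hyc _)).mul (huc _)).mul
      ((hη.continuous.mul (huc _)).pow 2)).integrable_of_hasCompactSupport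
      (hηc.mono fun x hx h0 => hx (by
        simp only [pow_eq_zero_iff n.succ_ne_zero] at h0
        simp [h0]))
  have hI : Integrable ((Metric.closedBall (0 : EuclideanSpace ℝ (Fin N)) (2 * R)).indicator
      (fun _ => M * R ^ (α + q * (α - β) - 2 - 2 * q))) :=
    (integrable_indicator_iff measurableSet_closedBall).2
      (integrableOn_const (measure_closedBall_lt_top.ne))
  have hQ : Integrable (fun x => (1 + ‖x‖ ^ 2) ^ (α / 2) * ((u x ^ (-s)) ^ 2
      * ‖gradient (fun x => φ x ^ (n + 1)) x‖ ^ 2)) := by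
    simp only [← mul_assoc]
    exact integrable_mul_norm_gradient_sq ((hyc _).mul ((huc _).pow 2))
      (hη.of_le (by norm_num)) hηc
  have hmain := integral_mono (hQ.const_mul C) ((hG.div_const 2).add hI) hpt
  rw [integral_add' (hG.div_const 2) hI, integral_const_mul, integral_div,
    integral_indicator measurableSet_closedBall, setIntegral_const, smul_eq_mul] at hmain
  have hvol : volume.real (Metric.closedBall (0 : EuclideanSpace ℝ (Fin N)) (2 * R))
      = (2 * R) ^ N * volume.real (Metric.closedBall (0 : EuclideanSpace ℝ (Fin N)) 1) := by
    rw [Measure.addHaar_real_closedBall' _ _ (by positivity), finrank_euclideanSpace_fin]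
  have hlow : ∫ x in Metric.ball 0 1, g x * (1 + ‖x‖ ^ 2) ^ (β / 2) * u x ^ (-p - 1)
      * (u x ^ (-s)) ^ 2 ≤ ∫ x, g x * (1 + ‖x‖ ^ 2) ^ (β / 2) * u x ^ (-p - 1)
      * (φ x ^ (n + 1) * u x ^ (-s)) ^ 2 := by
    refine le_trans (le_of_eq (setIntegral_congr_fun measurableSet_ball fun x hx => ?_))
      (setIntegral_le_integral hG (Eventually.of_forall fun x => ?_))
    · have : ‖x‖ ≤ R := (mem_ball_zero_iff.1 hx).le.trans hR
      simp [hφ1 x this]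
    · have h1 := hgpos x
      have h2 := Real.rpow_pos_of_pos (hy x) (β / 2)
      have h3 := Real.rpow_pos_of_pos (hupos x) (-p - 1)
      simp only [Pi.zero_apply]
      positivity
  have hexp : (2 * R) ^ N * R ^ (α + q * (α - β) - 2 - 2 * q)
      = 2 ^ N * R ^ (-(q * (β - α + 2) - (N + α - 2))) := by
    rw [mul_pow, ← Real.rpow_natCast R N, mul_assoc, ← Real.rpow_add hR0]
    congr 2
    ring
  have := henergy _ hη hηc
  rw [hvol] at hmain
  calc _ ≤ 2 * ((2 * R) ^ N * volume.real (Metric.closedBall (0 : EuclideanSpace ℝ (Fin N)) 1)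
        * (M * R ^ (α + q * (α - β) - 2 - 2 * q))) := by linarith
    _ = 2 * M * volume.real (Metric.closedBall (0 : EuclideanSpace ℝ (Fin N)) 1)
        * ((2 * R) ^ N * R ^ (α + q * (α - β) - 2 - 2 * q)) := by ring
    _ = _ := by rw [hexp]; ring

theorem stmt_17 (N : ℕ) (hN : 1 ≤ N) (p : ℝ) (hp : 0 < p) (α β : ℝ)
    (h1 : 0 < (N : ℝ) + α - 2)
    (h2 : (N : ℝ) + α - 2 < 2*(β - α + 2)/(p + 1) * (p + Real.sqrt (p * (p + 1))))
    (g : EuclideanSpace ℝ (Fin N) → ℝ) (hg : ContDiff ℝ (⊤ : ℕ∞) g) (hgpos : ∀ x, 0 < g x)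
    (c : ℝ) (hc : 0 < c) (hglim : Tendsto g (cocompact (EuclideanSpace ℝ (Fin N))) (nhds c)) :
    ¬ ∃ u : EuclideanSpace ℝ (Fin N) → ℝ, ContDiff ℝ 2 u ∧ (∀ x, 0 < u x) ∧
      (∀ x, -((fun x : EuclideanSpace ℝ (Fin N) => g x * (1 + ‖x‖^2) ^ (β/2)) x * u x ^ (-p)) ≤ -vdiv (fun y => (fun x : EuclideanSpace ℝ (Fin N) => (1 + ‖x‖^2) ^ (α/2)) y • gradient u y) x) ∧
      (∀ ψ : EuclideanSpace ℝ (Fin N) → ℝ, ContDiff ℝ 2 ψ → HasCompactSupport ψ →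
        ∫ x, p * (fun x : EuclideanSpace ℝ (Fin N) => g x * (1 + ‖x‖^2) ^ (β/2)) x * u x ^ (-p - 1) * ψ x ^ 2 ≤ ∫ x, (fun x : EuclideanSpace ℝ (Fin N) => (1 + ‖x‖^2) ^ (α/2)) x * ‖gradient ψ x‖ ^ 2) := by

  rintro ⟨u, hu, hupos, hsuper, hstable⟩
  have hy : ∀ x : EuclideanSpace ℝ (Fin N), 0 < 1 + ‖x‖ ^ 2 := fun x => by positivity
  have hω : ∀ γ : ℝ, ContDiff ℝ 1 fun x : EuclideanSpace ℝ (Fin N) => (1 + ‖x‖ ^ 2) ^ γ := fun γ =>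
    (contDiff_const.add (contDiff_norm_sq ℝ)).rpow_const_of_ne fun x => (hy x).ne'
  obtain ⟨s, hs, hsp, hsA⟩ := exists_subcritical_exponent hp h1 h2
  obtain ⟨C, hC, henergy⟩ := exists_integral_le_of_stable hs hsp (hω _)
    (fun x => Real.rpow_pos_of_pos (hy x) _) (hg.continuous.mul (hω _).continuous) hu hupos
    hsuper hstable
  obtain ⟨n, hn⟩ := exists_nat_ge (2 * s / (p + 1))
  obtain ⟨L, hcut⟩ := exists_cutoff (EuclideanSpace ℝ (Fin N))
  obtain ⟨R₀, hR₀⟩ : ∃ R₀ : ℝ, ∀ x : EuclideanSpace ℝ (Fin N), R₀ ≤ ‖x‖ → c / 2 ≤ g x := by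
    have h := hglim.eventually (lt_mem_nhds (half_lt_self hc))
    rw [← Metric.cobounded_eq_cocompact, ← comap_norm_atTop, eventually_comap] at h
    obtain ⟨R₀, hR₀⟩ := eventually_atTop.1 h
    exact ⟨R₀, fun x hx => (hR₀ _ hx x rfl).le⟩
  have huc : ∀ γ : ℝ, Continuous fun x => u x ^ γ := fun γ =>
    hu.continuous.rpow_const fun x => Or.inl (hupos x).ne'
  have hpos : 0 < ∫ x in Metric.ball 0 1,
      g x * (1 + ‖x‖ ^ 2) ^ (β / 2) * u x ^ (-p - 1) * (u x ^ (-s)) ^ 2 := by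
    have hcont : Continuous fun x =>
        g x * (1 + ‖x‖ ^ 2) ^ (β / 2) * u x ^ (-p - 1) * (u x ^ (-s)) ^ 2 :=
      ((hg.continuous.mul (hω _).continuous).mul (huc _)).mul ((huc _).pow 2)
    have hposx : ∀ x, 0 < g x * (1 + ‖x‖ ^ 2) ^ (β / 2) * u x ^ (-p - 1) * (u x ^ (-s)) ^ 2 :=
      fun x => mul_pos (mul_pos (mul_pos (hgpos x) (Real.rpow_pos_of_pos (hy x) _))
        (Real.rpow_pos_of_pos (hupos x) _)) (pow_pos (Real.rpow_pos_of_pos (hupos x) _) 2)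
    rw [setIntegral_pos_iff_support_of_nonneg_ae (Eventually.of_forall fun x => (hposx x).le)
      ((hcont.continuousOn.integrableOn_compact (isCompact_closedBall 0 1)).mono_set
        Metric.ball_subset_closedBall)]
    exact (Metric.measure_ball_pos _ 0 one_pos).trans_le
      (measure_mono fun x hx => ⟨(hposx x).ne', hx⟩)
  have hlim := ((tendsto_rpow_neg_atTop (sub_pos.2 hsA)).const_mul (2 * (C * (n + 1) ^ 2
    * (2 * (C * (n + 1) ^ 2) / (c / 2)) ^ (2 * s / (p + 1)) * L ^ 2 * (L ^ 2) ^ (2 * s / (p + 1))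
    * 5 ^ |(α + 2 * s / (p + 1) * (α - β)) / 2|) * 2 ^ N
    * volume.real (Metric.closedBall (0 : EuclideanSpace ℝ (Fin N)) 1)))
  rw [mul_zero] at hlim
  refine hpos.not_ge (ge_of_tendsto hlim ?_)
  filter_upwards [eventually_ge_atTop 1, eventually_ge_atTop R₀] with R hR1 hRR₀
  obtain ⟨φ, hφ, hφc, hφ01, hφ1, hφL, hφR⟩ := hcut R (by linarith)
  exact setIntegral_ball_le_of_energy hp hs hn hC (half_pos hc) hR1 hg.continuous hgpos
    (fun x hx => hR₀ x (hRR₀.trans hx)) hu.continuous hupos henergy hφ hφc hφ01 hφ1 hφL hφR rfl
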